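/- There exists a set X ⊆ ℕ that is high for paths but not high for tight descending sequences: every ill-founded computable tree has an X-computable path, yet some ill-founded computable linear order has no X-computable tight descending sequence. (The paper states this as: there is a degree high for isomorphism but not high for tight descending sequences; high for isomorphism coincides with high for paths.) -/

import Mathlib

namespace CFT

open Nat.Partrec (Code)

/-- Relativized partial recursive functions: `f` is partial recursive in the
(total) oracle `O : ℕ → ℕ`.  This mirrors Mathlib's `Nat.Partrec`, with an
extra constructor for the oracle. -/
inductive RecursiveIn (O : ℕ → ℕ) : (ℕ →. ℕ) → Prop
  | zero : RecursiveIn O (pure 0)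
  | succ : RecursiveIn O Nat.succ
  | left : RecursiveIn O ↑fun n : ℕ => n.unpair.1
  | right : RecursiveIn O ↑fun n : ℕ => n.unpair.2
  | oracle : RecursiveIn O ↑O
  | pair {f g} : RecursiveIn O f → RecursiveIn O g →
      RecursiveIn O fun n => Nat.pair <$> f n <*> g n
  | comp {f g} : RecursiveIn O f → RecursiveIn O g →
      RecursiveIn O fun n => g n >>= f
  | prec {f g} : RecursiveIn O f → RecursiveIn O g →
      RecursiveIn O (Nat.unpaired fun a n =>
        n.rec (f a) fun y IH => do let i ← IH; g (Nat.pair a (Nat.pair y i)))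
  | rfind {f} : RecursiveIn O f →
      RecursiveIn O fun a => Nat.rfind fun n => (fun m => m = 0) <$> f (Nat.pair a n)

/-- Partial functions between `Primcodable` types that are partial recursive in
the oracle `O`. -/
def PartrecIn (O : ℕ → ℕ) {α σ : Type} [Primcodable α] [Primcodable σ] (f : α →. σ) : Prop :=
  RecursiveIn O fun n =>
    Part.bind (Part.ofOption (Encodable.decode (α := α) n)) fun a => (f a).map Encodable.encode

/-- Total functions between `Primcodable` types that are computable in the oracle `O`. -/
def ComputableIn (O : ℕ → ℕ) {α σ : Type} [Primcodable α] [Primcodable σ] (f : α → σ) : Prop :=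
  PartrecIn O (f : α →. σ)

open Classical in
/-- The characteristic function of a set of naturals. -/
noncomputable def chi (A : Set ℕ) : ℕ → ℕ := fun n => if n ∈ A then 1 else 0

/-- `A` is computably enumerable in (the characteristic function of) `X`. -/
def CEIn (X : Set ℕ) (A : Set ℕ) : Prop :=
  ∃ f : ℕ →. ℕ, PartrecIn (chi X) f ∧ ∀ n, n ∈ A ↔ (f n).Dom

/-- The `e`-th partial computable function `ℕ →. ℕ`. -/
def codeFn (e : ℕ) : ℕ →. ℕ := (Denumerable.ofNat Code e).eval

/-! ### Trees on ℕ -/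

def PrefixClosed (T : Set (List ℕ)) : Prop := ∀ l ∈ T, ∀ l' : List ℕ, l' <+: l → l' ∈ T

/-- Index `e` decides a (prefix-closed) tree on `ℕ`. -/
def DecidesTree (e : ℕ) : Prop :=
  (∀ n, (codeFn e n).Dom) ∧
    PrefixClosed {l : List ℕ | codeFn e (Encodable.encode l) = Part.some 1}

open Classical in
/-- The standard enumeration of computable trees on ℕ; indices that do not
decide a tree denote the empty tree. -/
noncomputable def treeAt (e : ℕ) : Set (List ℕ) :=
  if DecidesTree e then {l : List ℕ | codeFn e (Encodable.encode l) = Part.some 1} else ∅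

/-- `f` is a path through the tree `T`: every finite initial segment
`[f 0, …, f (k-1)]` is in `T`. -/
def IsPath (T : Set (List ℕ)) (f : ℕ → ℕ) : Prop := ∀ k, (List.range k).map f ∈ T

def IllFounded (T : Set (List ℕ)) : Prop := ∃ f, IsPath T f

/-- The set of indices of well-founded computable trees. -/
def WF : Set ℕ := {e | ¬ IllFounded (treeAt e)}

/-- `T` is a computable tree (prefix-closed and decided by a total computable function). -/
def ComputableTree (T : Set (List ℕ)) : Prop :=
  PrefixClosed T ∧ ∃ χ : List ℕ → Bool, Computable χ ∧ ∀ l, l ∈ T ↔ χ l = true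

/-! ### Highness notions for paths -/

def HighForPaths (X : Set ℕ) : Prop :=
  ∀ T : Set (List ℕ), ComputableTree T → IllFounded T →
    ∃ f : ℕ → ℕ, ComputableIn (chi X) f ∧ IsPath T f

def LoqHighForPaths (X : Set ℕ) : Prop :=
  ∃ F : ℕ × ℕ → ℕ, ComputableIn (chi X) F ∧
    ∀ e, IllFounded (treeAt e) → IsPath (treeAt e) fun n => F (e, n)

def UnifHighForPaths (X : Set ℕ) : Prop :=
  ∃ F : ℕ × ℕ →. ℕ, PartrecIn (chi X) F ∧
    ∀ e, IllFounded (treeAt e) →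
      ∃ g : ℕ → ℕ, IsPath (treeAt e) g ∧ ∀ n, F (e, n) = Part.some (g n)

def RetHighForPaths (X : Set ℕ) : Prop :=
  ∃ F : ℕ × ℕ →. ℕ, PartrecIn (chi X) F ∧
    (∀ e, IllFounded (treeAt e) →
      ∃ g : ℕ → ℕ, IsPath (treeAt e) g ∧ ∀ n, F (e, n) = Part.some (g n)) ∧
    (∀ e, ¬ IllFounded (treeAt e) → ∀ n, ¬ (F (e, n)).Dom)

/-! ### Σ¹₁ and Π¹₁ sets -/

def Sigma11 (A : Set ℕ) : Prop :=
  ∃ R : ℕ → List ℕ → Bool, Computable₂ R ∧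
    ∀ n, n ∈ A ↔ ∃ f : ℕ → ℕ, ∀ k, R n ((List.range k).map f) = true

def Pi11 (A : Set ℕ) : Prop := Sigma11 Aᶜ

/-! ### Linear orders -/

/-- A (presentation of a) linear order: a domain `D ⊆ ℕ` and a strict order
relation on it. -/
structure LinOrd where
  dom : Set ℕ
  lt : ℕ → ℕ → Prop

/-- `L` really is a strict linear order on its domain. -/
def LinOrd.IsValid (L : LinOrd) : Prop :=
  (∀ a b, L.lt a b → a ∈ L.dom ∧ b ∈ L.dom) ∧
  (∀ a, ¬ L.lt a a) ∧
  (∀ a b c, L.lt a b → L.lt b c → L.lt a c) ∧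
  (∀ a ∈ L.dom, ∀ b ∈ L.dom, a = b ∨ L.lt a b ∨ L.lt b a)

def linOrdOfCodes (n : ℕ) : LinOrd :=
  ⟨{a | codeFn n.unpair.1 a = Part.some 1},
   fun a b => codeFn n.unpair.2 (Nat.pair a b) = Part.some 1⟩

def DecidesLinOrd (n : ℕ) : Prop :=
  (∀ m, (codeFn n.unpair.1 m).Dom) ∧ (∀ m, (codeFn n.unpair.2 m).Dom) ∧
    (linOrdOfCodes n).IsValid

open Classical in
/-- The standard enumeration of computable linear orders; indices that do not
decide a linear order denote the empty order. -/
noncomputable def linOrdAt (n : ℕ) : LinOrd :=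
  if DecidesLinOrd n then linOrdOfCodes n else ⟨∅, fun _ _ => False⟩

def IsDescSeq (L : LinOrd) (f : ℕ → ℕ) : Prop :=
  ∀ i, f i ∈ L.dom ∧ L.lt (f (i + 1)) (f i)

def LinOrd.IllFounded (L : LinOrd) : Prop := ∃ f, IsDescSeq L f

/-- A tight descending sequence: a descending sequence that gets below every
descending sequence. -/
def IsTightDescSeq (L : LinOrd) (f : ℕ → ℕ) : Prop :=
  IsDescSeq L f ∧ ∀ g, IsDescSeq L g → ∀ n, ∃ m, L.lt (f m) (g n)

/-- `L` is a computable linear order. -/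
def ComputableLinOrd (L : LinOrd) : Prop :=
  L.IsValid ∧
  (∃ χ : ℕ → Bool, Computable χ ∧ ∀ a, a ∈ L.dom ↔ χ a = true) ∧
  (∃ χ : ℕ → ℕ → Bool, Computable₂ χ ∧ ∀ a b, L.lt a b ↔ χ a b = true)

def LoqHighForDS (X : Set ℕ) : Prop :=
  ∃ g : ℕ × ℕ → ℕ, ComputableIn (chi X) g ∧
    ∀ n, (linOrdAt n).IllFounded → IsDescSeq (linOrdAt n) fun k => g (n, k)

def HighForTightDS (X : Set ℕ) : Prop :=
  ∀ L : LinOrd, ComputableLinOrd L → L.IllFounded →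
    ∃ f : ℕ → ℕ, ComputableIn (chi X) f ∧ IsTightDescSeq L f

def UnifHighForTightDS (X : Set ℕ) : Prop :=
  ∃ F : ℕ × ℕ →. ℕ, PartrecIn (chi X) F ∧
    ∀ n, (linOrdAt n).IllFounded →
      ∃ g : ℕ → ℕ, IsTightDescSeq (linOrdAt n) g ∧ ∀ k, F (n, k) = Part.some (g k)

/-! ### Binary trees -/

def PrefixClosedB (B : Set (List Bool)) : Prop := ∀ l ∈ B, ∀ l' : List Bool, l' <+: l → l' ∈ B

def DecidesBTree (e : ℕ) : Prop :=
  (∀ n, (codeFn e n).Dom) ∧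
    PrefixClosedB {l : List Bool | codeFn e (Encodable.encode l) = Part.some 1}

open Classical in
/-- The standard enumeration of computable binary trees; indices that do not
decide a binary tree denote the full binary tree. -/
noncomputable def bTreeAt (e : ℕ) : Set (List Bool) :=
  if DecidesBTree e then {l : List Bool | codeFn e (Encodable.encode l) = Part.some 1}
  else Set.univ

def BInfinite (B : Set (List Bool)) : Prop := ∀ k, ∃ l ∈ B, l.length = k

def IsBPath (B : Set (List Bool)) (p : ℕ → Bool) : Prop := ∀ k, (List.range k).map p ∈ B

open Encodable

section REPred

variable {α β : Type} [Primcodable α] [Primcodable β]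

theorem _root_.REPred.exists_code {p : α → Prop} (hp : REPred p) :
    ∃ c : Code, ∀ a, p a ↔ (c.eval (encode a)).Dom := by
  obtain ⟨c, hc⟩ := Code.exists_code.1 hp
  refine ⟨c, fun a => ?_⟩
  rw [hc]
  simp [Part.assert]

theorem _root_.REPred.exists_primrec {p : α → Prop} (hp : REPred p) :
    ∃ q : α → ℕ → Prop, PrimrecPred (fun x : α × ℕ => q x.1 x.2) ∧ ∀ a, p a ↔ ∃ s, q a s := by
  obtain ⟨c, hc⟩ := REPred.exists_code hp
  refine ⟨fun a s => (Code.evaln s c (encode a)).isSome, ?_, fun a => ?_⟩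
  · refine Primrec.primrecPred ?_
    simp only [Bool.decide_eq_true]
    exact Primrec.option_isSome.comp (Code.primrec_evaln.comp
      ((Primrec.snd.pair (Primrec.const c)).pair (Primrec.encode.comp Primrec.fst)))
  · rw [hc, Part.dom_iff_mem]
    simp only [Code.evaln_complete, Option.isSome_iff_exists, Option.mem_def]
    exact exists_comm

theorem rePred_of_primrec {p : α → Prop} {q : α → ℕ → Prop}
    (hq : PrimrecPred (fun x : α × ℕ => q x.1 x.2)) (h : ∀ a, p a ↔ ∃ s, q a s) : REPred p := by
  classical
  replace hq := hq.decide
  have : Partrec fun a => Nat.rfind fun s => Part.some (decide (q a s)) :=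
    Partrec.rfind (p := fun a s => Part.some (decide (q a s))) hq.to_comp.partrec
  refine this.dom_re.of_eq fun a => ?_
  refine Iff.trans Nat.rfind_dom ?_
  rw [h]
  constructor
  · rintro ⟨n, hn, -⟩
    exact ⟨n, by simpa using hn⟩
  · rintro ⟨n, hn⟩
    exact ⟨n, by simpa using hn, fun _ => trivial⟩

theorem _root_.REPred.comp {p : β → Prop} (hp : REPred p) {f : α → β} (hf : Computable f) :
    REPred fun a => p (f a) :=
  Partrec.comp hp hf

theorem _root_.REPred.and {p q : α → Prop} (hp : REPred p) (hq : REPred q) :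
    REPred fun a => p a ∧ q a := by
  have := Partrec.bind (g := fun a (_ : Unit) => Part.assert (q a) fun _ => Part.some ()) hp
    (hq.comp Computable.fst)
  refine this.dom_re.of_eq fun a => ?_
  simp [Part.assert, Part.bind_dom]

theorem _root_.REPred.or {p q : α → Prop} (hp : REPred p) (hq : REPred q) :
    REPred fun a => p a ∨ q a := by
  obtain ⟨p', hp', h1⟩ := REPred.exists_primrec hp
  obtain ⟨q', hq', h2⟩ := REPred.exists_primrec hq
  refine rePred_of_primrec (q := fun a s => p' a s ∨ q' a s) (hp'.or hq') fun a => ?_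
  rw [h1, h2, exists_or]

theorem _root_.REPred.exists_nat {p : α → ℕ → Prop} (hp : REPred fun x : α × ℕ => p x.1 x.2) :
    REPred fun a => ∃ n, p a n := by
  obtain ⟨q, hq, h⟩ := REPred.exists_primrec hp
  refine rePred_of_primrec (q := fun a s => q (a, s.unpair.1) s.unpair.2)
    (hq.comp (f := fun x : α × ℕ => ((x.1, x.2.unpair.1), x.2.unpair.2)) ?_) fun a => ?_
  · exact (Primrec.fst.pair (Primrec.fst.comp (Primrec.unpair.comp Primrec.snd))).pair
      (Primrec.snd.comp (Primrec.unpair.comp Primrec.snd))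
  · constructor
    · rintro ⟨n, hn⟩
      obtain ⟨s, hs⟩ := (h (a, n)).1 hn
      exact ⟨Nat.pair n s, by simpa using hs⟩
    · rintro ⟨s, hs⟩
      exact ⟨_, (h (a, s.unpair.1)).2 ⟨_, hs⟩⟩

theorem _root_.REPred.exists {p : α → β → Prop} (hp : REPred fun x : α × β => p x.1 x.2) :
    REPred fun a => ∃ b, p a b := by
  obtain ⟨q, hq, h⟩ := REPred.exists_primrec hp
  have : REPred fun x : α × ℕ => ∃ b ∈ (decode x.2 : Option β), p x.1 b := by
    have := Partrec.bind
      (g := fun (x : α × ℕ) (b : β) => Part.assert (p x.1 b) fun _ => Part.some ())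
      ((Computable.decode (α := β)).comp (Computable.snd (α := α))).ofOption
      (REPred.comp hp ((Computable.fst.comp Computable.fst).pair Computable.snd))
    refine this.dom_re.of_eq fun a => ?_
    simp [Part.assert, Part.bind_dom]
    cases h : (decode a.2 : Option β) <;> simp
  refine (REPred.exists_nat (p := fun a n => ∃ b ∈ (decode n : Option β), p a b) this).of_eq
    fun a => ?_
  constructor
  · rintro ⟨n, b, -, hb⟩
    exact ⟨b, hb⟩
  · rintro ⟨b, hb⟩
    exact ⟨encode b, b, by simp, hb⟩

theorem _root_.REPred.forall_lt {p : α → ℕ → Prop} (hp : REPred fun x : α × ℕ => p x.1 x.2)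
    {n : α → ℕ} (hn : Computable n) : REPred fun a => ∀ i < n a, p a i := by
  have := Partrec.nat_rec (f := n) (g := fun _ => Part.some ())
    (h := fun a (x : ℕ × Unit) => Part.assert (p a x.1) fun _ => Part.some ()) hn
    (Computable.const ()).partrec
    (REPred.comp hp (Computable.fst.pair (Computable.fst.comp Computable.snd)))
  refine this.dom_re.of_eq fun a => ?_
  generalize n a = m
  induction m with
  | zero => simp
  | succ m ih =>
    simp only [Part.bind_dom, Part.assert] at ih ⊢
    rw [Nat.forall_lt_succ_right, ← ih]
    simp

end REPred

/-- The initial segment `[f 0, …, f (k - 1)]`. -/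
def seg (f : ℕ → ℕ) (k : ℕ) : List ℕ := (List.range k).map f

@[simp] theorem length_seg (f : ℕ → ℕ) (k : ℕ) : (seg f k).length = k := by simp [seg]

theorem getElem?_seg {f : ℕ → ℕ} {k i : ℕ} (h : i < k) : (seg f k)[i]? = some (f i) := by
  simp [seg, h]

theorem take_seg {f : ℕ → ℕ} {j k : ℕ} (h : j ≤ k) : (seg f k).take j = seg f j := by
  simp [seg, ← List.map_take, List.take_range, h]

theorem seg_prefix (f : ℕ → ℕ) {j k : ℕ} (h : j ≤ k) : seg f j <+: seg f k := by
  rw [← take_seg h]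
  exact List.take_prefix _ _

theorem seg_congr {f g : ℕ → ℕ} {k : ℕ} (h : ∀ i < k, f i = g i) : seg f k = seg g k :=
  List.map_congr_left fun i hi => h i (List.mem_range.1 hi)

theorem seg_succ (f : ℕ → ℕ) (k : ℕ) : seg f (k + 1) = seg f k ++ [f k] := by
  simp [seg, List.range_succ]

/-- Every list is an initial segment of some function. -/
theorem seg_getD (l : List ℕ) : seg (fun i => l.getD i 0) l.length = l := by
  refine List.ext_getElem (by simp) fun i h1 h2 => ?_
  simp [seg, h2]

section EffOpen

variable {α β : Type} [Primcodable α] [Primcodable β]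

/-- `U` is an effectively open (`Σ⁰₁`) relation between elements of Baire space and elements
of `α`: whether `U f a` holds is enumerated from finite initial segments of `f`. -/
def EffOpen (U : (ℕ → ℕ) → α → Prop) : Prop :=
  ∃ Q : α → List ℕ → Prop, REPred (fun x : α × List ℕ => Q x.1 x.2) ∧
    (∀ a l l', l <+: l' → Q a l → Q a l') ∧ ∀ f a, U f a ↔ ∃ k, Q a (seg f k)

namespace EffOpen

theorem of_iff {U V : (ℕ → ℕ) → α → Prop} (hU : EffOpen U) (h : ∀ f a, U f a ↔ V f a) :
    EffOpen V := by
  obtain rfl : U = V := by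
    ext f a
    exact h f a
  exact hU

theorem of_re {p : α → Prop} (hp : REPred p) : EffOpen fun _ a => p a :=
  ⟨fun a _ => p a, hp.comp Computable.fst, fun _ _ _ _ h => h, fun _ _ => by simp⟩

theorem apply {t y : α → ℕ} (ht : Computable t) (hy : Computable y) :
    EffOpen fun f a => f (t a) = y a := by
  refine ⟨fun a l => l[t a]? = some (y a), ?_, ?_, ?_⟩
  · refine REPred.comp (p := fun x : Option ℕ × Option ℕ => x.1 = x.2) (f := fun x : α × List ℕ =>
      (x.2[t x.1]?, some (y x.1))) (Primrec.eq.computablePred.to_re) ?_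
    exact (Computable.list_getElem?.comp Computable.snd (ht.comp Computable.fst)).pair
      (Computable.option_some.comp (hy.comp Computable.fst))
  · rintro a l _ ⟨m, rfl⟩ h
    obtain ⟨h1, h2⟩ := List.getElem?_eq_some_iff.1 h
    rw [List.getElem?_append_left h1, h]
  · intro f a
    constructor
    · rintro h
      exact ⟨t a + 1, (getElem?_seg (Nat.lt_succ_self _)).trans (congrArg some h)⟩
    · rintro ⟨k, hk⟩
      have : t a < k := by
        have := (List.getElem?_eq_some_iff.1 hk).1
        simpa using this
      rw [getElem?_seg this] at hk
      simpa using hk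

theorem substParam {U : (ℕ → ℕ) → β → Prop} (hU : EffOpen U) {g : α → β} (hg : Computable g) :
    EffOpen fun f a => U f (g a) := by
  obtain ⟨Q, hQ, hm, h⟩ := hU
  exact ⟨fun a l => Q (g a) l,
    hQ.comp (f := fun x : α × List ℕ => (g x.1, x.2))
      ((hg.comp Computable.fst).pair Computable.snd), fun a => hm (g a), fun f a => h f (g a)⟩

theorem and {U V : (ℕ → ℕ) → α → Prop} (hU : EffOpen U) (hV : EffOpen V) :
    EffOpen fun f a => U f a ∧ V f a := by
  obtain ⟨Q, hQ, hm, h⟩ := hU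
  obtain ⟨Q', hQ', hm', h'⟩ := hV
  refine ⟨fun a l => Q a l ∧ Q' a l, hQ.and hQ',
    fun a l l' hl hq => ⟨hm a l l' hl hq.1, hm' a l l' hl hq.2⟩, fun f a => ?_⟩
  dsimp only
  rw [h, h']
  constructor
  · rintro ⟨⟨i, hi⟩, j, hj⟩
    exact ⟨max i j, hm _ _ _ (seg_prefix f (le_max_left _ _)) hi,
      hm' _ _ _ (seg_prefix f (le_max_right _ _)) hj⟩
  · rintro ⟨k, h1, h2⟩
    exact ⟨⟨k, h1⟩, k, h2⟩

theorem or {U V : (ℕ → ℕ) → α → Prop} (hU : EffOpen U) (hV : EffOpen V) :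
    EffOpen fun f a => U f a ∨ V f a := by
  obtain ⟨Q, hQ, hm, h⟩ := hU
  obtain ⟨Q', hQ', hm', h'⟩ := hV
  refine ⟨fun a l => Q a l ∨ Q' a l, hQ.or hQ',
    fun a l l' hl hq => hq.imp (hm a l l' hl) (hm' a l l' hl), fun f a => ?_⟩
  dsimp only
  rw [h, h', exists_or]

theorem ex {U : (ℕ → ℕ) → α → β → Prop} (hU : EffOpen fun f (x : α × β) => U f x.1 x.2) :
    EffOpen fun f a => ∃ b, U f a b := by
  obtain ⟨Q, hQ, hm, h⟩ := hU
  refine ⟨fun a l => ∃ b, Q (a, b) l, ?_, fun a l l' hl ⟨b, hb⟩ => ⟨b, hm _ l l' hl hb⟩,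
    fun f a => ?_⟩
  · exact REPred.exists (p := fun (x : α × List ℕ) b => Q (x.1, b) x.2)
      (hQ.comp (f := fun x : (α × List ℕ) × β => ((x.1.1, x.2), x.1.2))
        (((Computable.fst.comp Computable.fst).pair Computable.snd).pair
          (Computable.snd.comp Computable.fst)))
  · rw [exists_comm]
    exact exists_congr fun b => h f (a, b)

theorem forall_lt {U : (ℕ → ℕ) → α → ℕ → Prop} (hU : EffOpen fun f (x : α × ℕ) => U f x.1 x.2)
    {n : α → ℕ} (hn : Computable n) : EffOpen fun f a => ∀ i < n a, U f a i := by
  obtain ⟨Q, hQ, hm, h⟩ := hU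
  refine ⟨fun a l => ∀ i < n a, Q (a, i) l, ?_, fun a l l' hl hq i hi => hm _ l l' hl (hq i hi),
    fun f a => ?_⟩
  · exact REPred.forall_lt (p := fun (x : α × List ℕ) b => Q (x.1, b) x.2)
      (hQ.comp (f := fun x : (α × List ℕ) × ℕ => ((x.1.1, x.2), x.1.2))
        (((Computable.fst.comp Computable.fst).pair Computable.snd).pair
          (Computable.snd.comp Computable.fst))) (hn.comp Computable.fst)
  · constructor
    · intro H
      have : ∀ i, ∃ k, i < n a → Q (a, i) (seg f k) := fun i => by
        by_cases hi : i < n a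
        · obtain ⟨k, hk⟩ := (h f (a, i)).1 (H i hi)
          exact ⟨k, fun _ => hk⟩
        · exact ⟨0, fun h => absurd h hi⟩
      choose k hk using this
      refine ⟨(Finset.range (n a)).sup k, fun i hi => hm _ _ _ (seg_prefix f ?_) (hk i hi)⟩
      exact Finset.le_sup (Finset.mem_range.2 hi)
    · rintro ⟨k, hk⟩ i hi
      exact (h f (a, i)).2 ⟨k, hk i hi⟩

/-- Effectively open relations are preserved by precomposition with a computable reindexing. -/
theorem reindex {U : (ℕ → ℕ) → α → Prop} (hU : EffOpen U) {g : ℕ → ℕ} (hg : Computable g) :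
    EffOpen fun f a => U (f ∘ g) a := by
  obtain ⟨Q, hQ, hm, h⟩ := hU
  have key : EffOpen fun f (a : α) => ∃ l : List ℕ, Q a l ∧
      ∀ i < l.length, f (g i) = l.getD i 0 := by
    refine ex (U := fun f a l => Q a l ∧ ∀ i < l.length, f (g i) = l.getD i 0)
      ((of_re hQ).and ?_)
    refine forall_lt (U := fun f (x : α × List ℕ) i => f (g i) = x.2.getD i 0) ?_
      (Computable.list_length.comp Computable.snd)
    exact apply (hg.comp Computable.snd)
      ((Primrec.list_getD 0).to_comp.comp (Computable.snd.comp Computable.fst) Computable.snd)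
  refine key.of_iff fun f a => ?_
  rw [h]
  constructor
  · rintro ⟨l, hl, hf⟩
    refine ⟨l.length, ?_⟩
    rwa [seg_congr (f := f ∘ g) (g := fun i => l.getD i 0) hf, seg_getD]
  · rintro ⟨k, hk⟩
    refine ⟨_, hk, fun i hi => ?_⟩
    simp only [length_seg] at hi
    simp [List.getD, getElem?_seg hi]

theorem countable : {U : (ℕ → ℕ) → α → Prop | EffOpen U}.Countable := by
  refine (Set.countable_range fun (c : Code) (f : ℕ → ℕ) (a : α) =>
    ∃ k, (c.eval (encode (a, seg f k))).Dom).mono ?_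
  rintro U ⟨Q, hQ, -, h⟩
  obtain ⟨c, hc⟩ := hQ.exists_code
  refine ⟨c, ?_⟩
  ext f a
  rw [h]
  exact exists_congr fun k => (hc (a, seg f k)).symm

end EffOpen

end EffOpen

section RecursiveIn

theorem RecursiveIn.of_partrec {O : ℕ → ℕ} {g : ℕ →. ℕ} (hg : Nat.Partrec g) :
    RecursiveIn O g := by
  induction hg with
  | zero => exact .zero
  | succ => exact .succ
  | left => exact .left
  | right => exact .right
  | pair _ _ h1 h2 => exact .pair h1 h2
  | comp _ _ h1 h2 => exact .comp h1 h2
  | prec _ _ h1 h2 => exact .prec h1 h2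
  | rfind _ h => exact .rfind h

theorem computableIn_nat {O f : ℕ → ℕ} : ComputableIn O f ↔ RecursiveIn O ↑f := by
  have : (fun n => Part.bind (Part.ofOption (decode (α := ℕ) n)) fun a =>
      ((f : ℕ →. ℕ) a).map encode) = (f : ℕ →. ℕ) := by
    funext n
    simp
  rw [ComputableIn, PartrecIn, this]

/-- The complement of the graph of `F`, as a set of naturals. -/
def coGraph (F : ℕ → ℕ) : Set ℕ := {n | F n.unpair.1 ≠ n.unpair.2}

theorem recursiveIn_coGraph (F : ℕ → ℕ) : RecursiveIn (chi (coGraph F)) ↑F := by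
  have h := RecursiveIn.rfind (RecursiveIn.oracle (O := chi (coGraph F)))
  have h0 : ∀ a n, chi (coGraph F) (Nat.pair a n) = 0 ↔ F a = n := fun a n => by
    simp [chi, coGraph]
  suffices H : (F : ℕ →. ℕ) = _ by rwa [H]
  funext a
  refine (Part.eq_some_iff.2 (Nat.mem_rfind.2 ⟨?_, fun {m} hm => ?_⟩)).symm
  · simp [h0]
  · have : F a ≠ m := (ne_of_lt hm).symm
    simp [h0, this]

theorem computableIn_coGraph_comp (F : ℕ → ℕ) {g : ℕ → ℕ} (hg : Computable g) :
    ComputableIn (chi (coGraph F)) (F ∘ g) := by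
  rw [computableIn_nat]
  have := (recursiveIn_coGraph F).comp (RecursiveIn.of_partrec (Partrec.nat_iff.1 hg))
  suffices H : ((F ∘ g : ℕ → ℕ) : ℕ →. ℕ) = fun n => (g : ℕ →. ℕ) n >>= (F : ℕ →. ℕ) by rwa [H]
  funext n
  exact (Part.bind_some _ _).symm

theorem mem_natRec_iff {x : Part ℕ} {g : ℕ → ℕ → Part ℕ} {n z : ℕ} :
    z ∈ (n.rec x fun y IH => do let i ← IH; g y i : Part ℕ) ↔
      ∃ s : List ℕ, (∃ u ∈ x, s[0]? = some u) ∧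
        (∀ i < n, ∃ u, s[i]? = some u ∧ ∃ v, s[i + 1]? = some v ∧ v ∈ g i u) ∧
          s[n]? = some z := by
  constructor
  · suffices H : z ∈ (n.rec x fun y IH => do let i ← IH; g y i : Part ℕ) →
        ∃ s : List ℕ, s.length = n + 1 ∧ (∃ u ∈ x, s[0]? = some u) ∧
          (∀ i < n, ∃ u, s[i]? = some u ∧ ∃ v, s[i + 1]? = some v ∧ v ∈ g i u) ∧
            s[n]? = some z from fun h => let ⟨s, _, hs⟩ := H h; ⟨s, hs⟩
    induction n generalizing z with
    | zero => exact fun h => ⟨[z], by simp, ⟨z, h, by simp⟩, by simp, by simp⟩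
    | succ n ih =>
      intro h
      obtain ⟨w, hw, hz⟩ := Part.mem_bind_iff.1 h
      obtain ⟨s, hl, ⟨u, hu, hu'⟩, h2, h3⟩ := ih hw
      have mono : ∀ {i v}, s[i]? = some v → (s ++ [z])[i]? = some v := fun {i v} h => by
        rw [List.getElem?_append_left (List.getElem?_eq_some_iff.1 h).1, h]
      have last : (s ++ [z])[n + 1]? = some z := by
        rw [List.getElem?_append_right hl.le]
        simp [hl]
      refine ⟨s ++ [z], by simp [hl], ⟨u, hu, mono hu'⟩, fun i hi => ?_, last⟩
      rcases Nat.lt_succ_iff_lt_or_eq.1 hi with hi | rfl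
      · obtain ⟨u, hu, v, hv, hg⟩ := h2 i hi
        exact ⟨u, mono hu, v, mono hv, hg⟩
      · exact ⟨w, mono h3, z, last, hz⟩
  · rintro ⟨s, ⟨u, hu, hu'⟩, h2, h3⟩
    induction n generalizing z with
    | zero =>
      obtain rfl : u = z := by simpa [hu'] using h3
      exact hu
    | succ n ih =>
      obtain ⟨w, hw, v, hv, hg⟩ := h2 n (Nat.lt_succ_self n)
      obtain rfl : v = z := by simpa [hv] using h3
      exact Part.mem_bind_iff.2 ⟨w, ih (fun i hi => h2 i (Nat.lt_succ_of_lt hi)) hw, hg⟩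

/-- The graph of a function recursive in `coGraph F` is given by an effectively open relation
evaluated at `F`. -/
theorem RecursiveIn.exists_effOpen {F : ℕ → ℕ} {g : ℕ →. ℕ}
    (hg : RecursiveIn (chi (coGraph F)) g) :
    ∃ G : (ℕ → ℕ) → ℕ × ℕ → Prop, EffOpen G ∧ ∀ x y, y ∈ g x ↔ G F (x, y) := by
  have of_computable : ∀ t : ℕ → ℕ, Computable t →
      ∃ G : (ℕ → ℕ) → ℕ × ℕ → Prop, EffOpen G ∧ ∀ x y, y ∈ (t : ℕ →. ℕ) x ↔ G F (x, y) :=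
    fun t ht => ⟨fun _ a => a.2 = t a.1,
      .of_re (REPred.comp (p := fun x : ℕ × ℕ => x.1 = x.2) (f := fun x : ℕ × ℕ => (x.2, t x.1))
        Primrec.eq.computablePred.to_re
        (Computable.snd.pair (ht.comp Computable.fst))), fun x y => by simp⟩
  have eqRe : ∀ {α : Type} [Primcodable α] (s t : α → ℕ), Computable s → Computable t →
      REPred fun a => s a = t a := fun s t hs ht =>
    REPred.comp (p := fun x : ℕ × ℕ => x.1 = x.2) Primrec.eq.computablePred.to_re (hs.pair ht)
  induction hg with
  | zero => exact of_computable _ (Computable.const 0)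
  | succ => exact of_computable _ Computable.succ
  | left => exact of_computable _ (Computable.fst.comp Computable.unpair)
  | right => exact of_computable _ (Computable.snd.comp Computable.unpair)
  | oracle =>
    refine ⟨fun f a => (a.2 = 0 ∧ f a.1.unpair.1 = a.1.unpair.2) ∨
      (a.2 = 1 ∧ ∃ z, z ≠ a.1.unpair.2 ∧ f a.1.unpair.1 = z), ?_, fun x y => ?_⟩
    · have u1 : Computable fun a : ℕ × ℕ => a.1.unpair.1 :=
        Computable.fst.comp (Computable.unpair.comp Computable.fst)
      have u2 : Computable fun a : ℕ × ℕ => a.1.unpair.2 :=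
        Computable.snd.comp (Computable.unpair.comp Computable.fst)
      refine EffOpen.or (EffOpen.and (.of_re (eqRe _ _ Computable.snd (Computable.const 0)))
        (EffOpen.apply u1 u2)) (EffOpen.and
          (.of_re (eqRe _ _ Computable.snd (Computable.const 1)))
          (EffOpen.ex (U := fun f (a : ℕ × ℕ) z => z ≠ a.1.unpair.2 ∧ f a.1.unpair.1 = z)
            (EffOpen.and (.of_re ?_) (EffOpen.apply (u1.comp Computable.fst) Computable.snd))))
      exact REPred.comp (p := fun x : ℕ × ℕ => ¬ x.1 = x.2)
        (f := fun x : (ℕ × ℕ) × ℕ => (x.2, x.1.1.unpair.2))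
        Primrec.eq.computablePred.not.to_re (Computable.snd.pair (u2.comp Computable.fst))
    · by_cases h : F x.unpair.1 = x.unpair.2 <;> simp [chi, coGraph, h]
  | @pair g1 g2 _ _ h1 h2 =>
    obtain ⟨G1, o1, h1⟩ := h1
    obtain ⟨G2, o2, h2⟩ := h2
    refine ⟨fun f a => ∃ w : ℕ × ℕ, G1 f (a.1, w.1) ∧ G2 f (a.1, w.2) ∧ a.2 = Nat.pair w.1 w.2,
      ?_, fun x y => ?_⟩
    · refine EffOpen.ex (U := fun f (a : ℕ × ℕ) (w : ℕ × ℕ) =>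
        G1 f (a.1, w.1) ∧ G2 f (a.1, w.2) ∧ a.2 = Nat.pair w.1 w.2) ?_
      refine (o1.substParam (g := fun x : (ℕ × ℕ) × ℕ × ℕ => (x.1.1, x.2.1)) ?_).and
        ((o2.substParam (g := fun x : (ℕ × ℕ) × ℕ × ℕ => (x.1.1, x.2.2)) ?_).and
          (.of_re (eqRe _ _ ?_ ?_)))
      · exact (Computable.fst.comp Computable.fst).pair (Computable.fst.comp Computable.snd)
      · exact (Computable.fst.comp Computable.fst).pair (Computable.snd.comp Computable.snd)
      · exact Computable.snd.comp Computable.fst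
      · exact Primrec₂.natPair.to_comp.comp (Computable.fst.comp Computable.snd)
          (Computable.snd.comp Computable.snd)
    · simp only [Seq.seq, ← h1, ← h2, Part.map_eq_map, Part.mem_bind_iff, Part.mem_map_iff]
      constructor
      · rintro ⟨_, ⟨a, ha, rfl⟩, b, hb, rfl⟩
        exact ⟨(a, b), ha, hb, rfl⟩
      · rintro ⟨⟨a, b⟩, ha, hb, rfl⟩
        exact ⟨_, ⟨a, ha, rfl⟩, b, hb, rfl⟩
  | @comp g1 g2 _ _ h1 h2 =>
    obtain ⟨G1, o1, h1⟩ := h1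
    obtain ⟨G2, o2, h2⟩ := h2
    refine ⟨fun f a => ∃ w : ℕ, G2 f (a.1, w) ∧ G1 f (w, a.2), ?_, fun x y => ?_⟩
    · refine EffOpen.ex (U := fun f (a : ℕ × ℕ) (w : ℕ) => G2 f (a.1, w) ∧ G1 f (w, a.2)) ?_
      refine (o2.substParam (g := fun x : (ℕ × ℕ) × ℕ => (x.1.1, x.2)) ?_).and
        (o1.substParam (g := fun x : (ℕ × ℕ) × ℕ => (x.2, x.1.2)) ?_)
      · exact (Computable.fst.comp Computable.fst).pair Computable.snd
      · exact Computable.snd.pair (Computable.snd.comp Computable.fst)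
    · simp only [← h1, ← h2]
      exact Part.mem_bind_iff
  | @prec g1 g2 _ _ h1 h2 =>
    obtain ⟨G1, o1, h1⟩ := h1
    obtain ⟨G2, o2, h2⟩ := h2
    refine ⟨fun f a => ∃ s : List ℕ, (∃ u, G1 f (a.1.unpair.1, u) ∧ s[0]? = some u) ∧
      (∀ i < a.1.unpair.2, ∃ u, s[i]? = some u ∧ ∃ v, s[i + 1]? = some v ∧
        G2 f (Nat.pair a.1.unpair.1 (Nat.pair i u), v)) ∧ s[a.1.unpair.2]? = some a.2,
      ?_, fun x y => ?_⟩
    · have u1 : Computable fun a : ℕ × ℕ => a.1.unpair.1 :=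
        Computable.fst.comp (Computable.unpair.comp Computable.fst)
      have u2 : Computable fun a : ℕ × ℕ => a.1.unpair.2 :=
        Computable.snd.comp (Computable.unpair.comp Computable.fst)
      have getRe : ∀ {α : Type} [Primcodable α] {s : α → List ℕ} {i v : α → ℕ}, Computable s →
          Computable i → Computable v → EffOpen fun _ a => (s a)[i a]? = some (v a) :=
        fun {α _ s i v} hs hi hv => .of_re <|
          REPred.comp (p := fun x : Option ℕ × Option ℕ => x.1 = x.2)
            (f := fun a => ((s a)[i a]?, some (v a)))
            Primrec.eq.computablePred.to_re
            ((Computable.list_getElem?.comp hs hi).pair (Computable.option_some.comp hv))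
      refine EffOpen.ex (U := fun f (a : ℕ × ℕ) (s : List ℕ) =>
        (∃ u, G1 f (a.1.unpair.1, u) ∧ s[0]? = some u) ∧
          (∀ i < a.1.unpair.2, ∃ u, s[i]? = some u ∧ ∃ v, s[i + 1]? = some v ∧
          G2 f (Nat.pair a.1.unpair.1 (Nat.pair i u), v)) ∧ s[a.1.unpair.2]? = some a.2) ?_
      refine EffOpen.and ?_ (EffOpen.and ?_ (getRe Computable.snd
        (u2.comp Computable.fst) (Computable.snd.comp Computable.fst)))
      · refine EffOpen.ex (U := fun f (x : (ℕ × ℕ) × List ℕ) (u : ℕ) =>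
          G1 f (x.1.1.unpair.1, u) ∧ x.2[0]? = some u) (EffOpen.and
            (o1.substParam (g := fun x : ((ℕ × ℕ) × List ℕ) × ℕ => (x.1.1.1.unpair.1, x.2)) ?_)
            (getRe (Computable.snd.comp Computable.fst) (Computable.const 0) Computable.snd))
        exact (u1.comp (Computable.fst.comp Computable.fst)).pair Computable.snd
      · refine EffOpen.forall_lt (U := fun f (x : (ℕ × ℕ) × List ℕ) i =>
          ∃ u, x.2[i]? = some u ∧ ∃ v, x.2[i + 1]? = some v ∧
            G2 f (Nat.pair x.1.1.unpair.1 (Nat.pair i u), v)) ?_ (u2.comp Computable.fst)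
        refine EffOpen.ex (U := fun f (x : ((ℕ × ℕ) × List ℕ) × ℕ) u =>
          x.1.2[x.2]? = some u ∧ ∃ v, x.1.2[x.2 + 1]? = some v ∧
            G2 f (Nat.pair x.1.1.1.unpair.1 (Nat.pair x.2 u), v)) (EffOpen.and ?_ ?_)
        · exact getRe (Computable.snd.comp (Computable.fst.comp Computable.fst))
            (Computable.snd.comp Computable.fst) Computable.snd
        · refine EffOpen.ex (U := fun f (x : (((ℕ × ℕ) × List ℕ) × ℕ) × ℕ) v =>
            x.1.1.2[x.1.2 + 1]? = some v ∧
              G2 f (Nat.pair x.1.1.1.1.unpair.1 (Nat.pair x.1.2 x.2), v)) (EffOpen.and ?_ ?_)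
          · exact getRe (Computable.snd.comp (Computable.fst.comp
              (Computable.fst.comp Computable.fst)))
              (Computable.succ.comp (Computable.snd.comp (Computable.fst.comp Computable.fst)))
              Computable.snd
          · refine o2.substParam (g := fun x : ((((ℕ × ℕ) × List ℕ) × ℕ) × ℕ) × ℕ =>
              (Nat.pair x.1.1.1.1.1.unpair.1 (Nat.pair x.1.1.2 x.1.2), x.2)) ?_
            refine Computable.pair (Primrec₂.natPair.to_comp.comp
              (u1.comp (Computable.fst.comp (Computable.fst.comp
                (Computable.fst.comp Computable.fst))))
              (Primrec₂.natPair.to_comp.comp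
                (Computable.snd.comp (Computable.fst.comp Computable.fst))
                (Computable.snd.comp Computable.fst))) Computable.snd
    · simp only [← h1, ← h2]
      exact mem_natRec_iff (g := fun y i => g2 (Nat.pair x.unpair.1 (Nat.pair y i)))
  | @rfind g1 _ h1 =>
    obtain ⟨G1, o1, h1⟩ := h1
    refine ⟨fun f a => G1 f (Nat.pair a.1 a.2, 0) ∧
      ∀ m < a.2, ∃ v, v ≠ 0 ∧ G1 f (Nat.pair a.1 m, v), ?_, fun x y => ?_⟩
    · refine EffOpen.and (o1.substParam (g := fun a : ℕ × ℕ => (Nat.pair a.1 a.2, 0)) ?_)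
        (EffOpen.forall_lt (U := fun f (a : ℕ × ℕ) m => ∃ v, v ≠ 0 ∧ G1 f (Nat.pair a.1 m, v))
          (EffOpen.ex (U := fun f (x : (ℕ × ℕ) × ℕ) v => v ≠ 0 ∧ G1 f (Nat.pair x.1.1 x.2, v))
            (EffOpen.and (.of_re ?_) (o1.substParam
              (g := fun x : ((ℕ × ℕ) × ℕ) × ℕ => (Nat.pair x.1.1.1 x.1.2, x.2)) ?_)))
          Computable.snd)
      · exact (Primrec₂.natPair.to_comp.comp Computable.fst Computable.snd).pair
          (Computable.const 0)
      · exact REPred.comp (p := fun x : ℕ × ℕ => ¬ x.1 = x.2)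
          (f := fun x : ((ℕ × ℕ) × ℕ) × ℕ => (x.2, 0))
          Primrec.eq.computablePred.not.to_re (Computable.snd.pair (Computable.const 0))
      · exact (Primrec₂.natPair.to_comp.comp
          (Computable.fst.comp (Computable.fst.comp Computable.fst))
          (Computable.snd.comp Computable.fst)).pair Computable.snd
    · refine Nat.mem_rfind.trans ?_
      simp [← h1, and_comm]

end RecursiveIn

section Forcing

/-- Two elements of Baire space agree on the first `k` columns. -/
def AgreeBelow (k : ℕ) (f g : ℕ → ℕ) : Prop := ∀ i, i.unpair.1 < k → f i = g i

theorem AgreeBelow.mono {j k : ℕ} (h : j ≤ k) {f g : ℕ → ℕ} (hfg : AgreeBelow k f g) :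
    AgreeBelow j f g :=
  fun i hi => hfg i (hi.trans_le h)

theorem AgreeBelow.seg_eq {k : ℕ} {f g : ℕ → ℕ} (h : AgreeBelow k f g) : seg f k = seg g k :=
  seg_congr fun i hi => h i ((Nat.unpair_left_le i).trans_lt hi)

/-- A forcing condition: a nonempty `Π⁰₁` class which constrains only finitely many columns. -/
structure IsCondition (C : Set (ℕ → ℕ)) : Prop where
  nonempty : C.Nonempty
  closed : ∃ U : (ℕ → ℕ) → Unit → Prop, EffOpen U ∧ ∀ f, f ∈ C ↔ ¬ U f ()
  bounded : ∃ k, ∀ f g, AgreeBelow k f g → f ∈ C → g ∈ C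

theorem isCondition_univ : IsCondition Set.univ where
  nonempty := Set.univ_nonempty
  closed := ⟨fun _ _ => ¬ True, .of_re (ComputablePred.to_re ((Computable.const false).of_eq
    (by simp)).computablePred), by simp⟩
  bounded := ⟨0, by simp⟩

theorem IsCondition.inter {C : Set (ℕ → ℕ)} (hC : IsCondition C) {V : (ℕ → ℕ) → Unit → Prop}
    (hV : EffOpen V) (hne : ∃ f ∈ C, ¬ V f ()) {k : ℕ}
    (hk : ∀ f g, AgreeBelow k f g → ¬ V f () → ¬ V g ()) :
    IsCondition (C ∩ {f | ¬ V f ()}) where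
  nonempty := hne
  closed := by
    obtain ⟨U, hU, h⟩ := hC.closed
    exact ⟨_, hU.or hV, fun f => by simp [h]⟩
  bounded := by
    obtain ⟨j, hj⟩ := hC.bounded
    exact ⟨max j k, fun f g hfg hf => ⟨hj f g (hfg.mono (le_max_left _ _)) hf.1,
      hk f g (hfg.mono (le_max_right _ _)) hf.2⟩⟩

theorem IsCondition.inter_seg {C : Set (ℕ → ℕ)} (hC : IsCondition C) {f : ℕ → ℕ} (hf : f ∈ C)
    (k : ℕ) : IsCondition (C ∩ {g | seg g k = seg f k}) := by
  have key : ∀ g, seg g k = seg f k ↔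
      ¬ ∃ x : ℕ × ℕ, (x.1 < k ∧ ¬ (seg f k).getD x.1 0 = x.2) ∧ g x.1 = x.2 := by
    intro g
    constructor
    · rintro h ⟨⟨i, v⟩, ⟨hi, hv⟩, hg⟩
      rw [← h, List.getD, getElem?_seg hi] at hv
      exact hv hg
    · intro h
      refine seg_congr fun i hi => ?_
      by_contra hne
      refine h ⟨(i, g i), ⟨hi, fun hv => hne ?_⟩, rfl⟩
      rw [List.getD, getElem?_seg hi] at hv
      exact hv.symm
  simp only [key]
  refine hC.inter (V := fun g _ =>
    ∃ x : ℕ × ℕ, (x.1 < k ∧ ¬ (seg f k).getD x.1 0 = x.2) ∧ g x.1 = x.2) (k := k) ?_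
    ⟨f, hf, (key f).1 rfl⟩ fun g h hgh => ?_
  · refine EffOpen.ex (U := fun g (_ : Unit) (x : ℕ × ℕ) =>
      (x.1 < k ∧ ¬ (seg f k).getD x.1 0 = x.2) ∧ g x.1 = x.2) (EffOpen.and (.of_re ?_)
        (EffOpen.apply (Computable.fst.comp Computable.snd) (Computable.snd.comp Computable.snd)))
    refine PrimrecPred.computablePred (PrimrecPred.and ?_ (PrimrecPred.not ?_)) |>.to_re
    · exact Primrec.nat_lt.comp (Primrec.fst.comp Primrec.snd) (Primrec.const k)
    · exact Primrec.eq.comp ((Primrec.list_getD 0).comp (Primrec.const _)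
        (Primrec.fst.comp Primrec.snd)) (Primrec.snd.comp Primrec.snd)
  · rw [← key, ← key, hgh.seg_eq]
    exact id

/-- For countably many dense sets of conditions there is an element of Baire space lying in a
condition from each of them. -/
theorem exists_generic {ι : Type*} [Countable ι] (D : ι → Set (Set (ℕ → ℕ)))
    (hD : ∀ i C, IsCondition C → ∃ C' ⊆ C, IsCondition C' ∧ C' ∈ D i) :
    ∃ F : ℕ → ℕ, ∀ i, ∃ C ∈ D i, F ∈ C := by
  rcases isEmpty_or_nonempty ι with _ | _
  · exact ⟨0, fun i => isEmptyElim i⟩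
  obtain ⟨e, he⟩ := exists_surjective_nat ι
  have step : ∀ (n : ℕ) (C : {C // IsCondition C}), ∃ C' : {C // IsCondition C},
      C'.1 ⊆ C.1 ∧ C'.1 ∈ D (e n) ∧ ∃ l, ∀ f ∈ C'.1, seg f n = l := by
    rintro n ⟨C, hC⟩
    obtain ⟨f, hf⟩ := hC.nonempty
    obtain ⟨C', hsub, hC', hm⟩ := hD (e n) _ (hC.inter_seg hf n)
    exact ⟨⟨C', hC'⟩, fun g hg => (hsub hg).1, hm, seg f n, fun g hg => (hsub hg).2⟩
  choose next hsub hdense hdet using step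
  let C : ℕ → {C // IsCondition C} := fun n => Nat.rec ⟨_, isCondition_univ⟩ next n
  have anti : Antitone fun n => (C n).1 := antitone_nat_of_succ_le fun n => hsub n (C n)
  choose f hf using fun n => (C n).2.nonempty
  have coh : ∀ {k m n}, k < m → k < n → seg (f m) k = seg (f n) k := fun {k m n} hm hn => by
    obtain ⟨l, hl⟩ := hdet k (C k)
    rw [hl (f m) (anti (Nat.succ_le_of_lt hm) (hf m)), hl (f n) (anti (Nat.succ_le_of_lt hn) (hf n))]
  have lim : ∀ {k m}, k < m → seg (fun i => f (i + 2) i) k = seg (f m) k := fun {k m} hm => by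
    refine seg_congr fun i hi => ?_
    have := congrArg (·[i]?) (coh (Nat.lt_succ_self (i + 1)) (show i + 1 < m by omega))
    simp only [getElem?_seg (Nat.lt_succ_self i)] at this
    exact Option.some_inj.1 this
  refine ⟨fun i => f (i + 2) i, fun i => ?_⟩
  obtain ⟨n, rfl⟩ := he i
  refine ⟨_, hdense n (C n), ?_⟩
  change _ ∈ (C (n + 1)).1
  obtain ⟨U, ⟨Q, -, -, hQ⟩, hU⟩ := (C (n + 1)).2.closed
  rw [hU, hQ]
  rintro ⟨k, hk⟩
  have hmem : f (max (n + 1) (k + 1)) ∈ (C (n + 1)).1 :=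
    anti (le_max_left (n + 1) (k + 1)) (hf (max (n + 1) (k + 1)))
  rw [hU, hQ] at hmem
  refine hmem ⟨k, ?_⟩
  rwa [← lim (lt_of_lt_of_le (Nat.lt_succ_self k) (le_max_right _ _))]

/-- A set is `Σ¹₁` if it is the projection of a `Π⁰₁` relation. -/
def IsSigma11 {α : Type} [Primcodable α] (A : α → Prop) : Prop :=
  ∃ U : (ℕ → ℕ) → α → Prop, EffOpen U ∧ ∀ a, A a ↔ ∃ f, ¬ U f a

theorem exists_condition_ne {α : Type} [Primcodable α] {W : α → Prop} (hW : ¬ IsSigma11 W)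
    {V : (ℕ → ℕ) → α → Prop} (hV : EffOpen V) {C : Set (ℕ → ℕ)} (hC : IsCondition C) :
    ∃ C' ⊆ C, IsCondition C' ∧ ∃ x, ∀ f ∈ C', ¬ (W x ↔ ¬ V f x) := by
  obtain ⟨U, hU, hUC⟩ := hC.closed
  obtain ⟨k, hk⟩ := hC.bounded
  have hV' : EffOpen fun f x => ∃ g, AgreeBelow k f g ∧ V g x := by
    obtain ⟨Q, hQ, hm, h⟩ := hV
    have : EffOpen fun f x => ∃ l : List ℕ, Q x l ∧
        ∀ i < l.length, k ≤ i.unpair.1 ∨ f i = l.getD i 0 := by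
      refine EffOpen.ex (U := fun f x l => Q x l ∧
        ∀ i < l.length, k ≤ i.unpair.1 ∨ f i = l.getD i 0) ((EffOpen.of_re hQ).and ?_)
      refine EffOpen.forall_lt (U := fun f (x : α × List ℕ) i =>
        k ≤ i.unpair.1 ∨ f i = x.2.getD i 0) (EffOpen.or (.of_re ?_) (EffOpen.apply
          Computable.snd ?_)) (Computable.list_length.comp Computable.snd)
      · exact (Primrec.nat_le.comp (Primrec.const k)
          (Primrec.fst.comp (Primrec.unpair.comp Primrec.snd))).computablePred.to_re
      · exact (Primrec.list_getD 0).to_comp.comp (Computable.snd.comp Computable.fst)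
          Computable.snd
    refine this.of_iff fun f x => ?_
    constructor
    · rintro ⟨l, hl, hf⟩
      refine ⟨fun i => if i < l.length then l.getD i 0 else f i, fun i hi => ?_,
        (h _ _).2 ⟨l.length, ?_⟩⟩
      · dsimp only
        split_ifs with hlt
        · exact (hf i hlt).resolve_left hi.not_ge
        · rfl
      · rwa [seg_congr (g := fun i => l.getD i 0) fun i hi => if_pos hi, seg_getD]
    · rintro ⟨g, hg, hV⟩
      obtain ⟨n, hn⟩ := (h _ _).1 hV
      refine ⟨_, hn, fun i hi => ?_⟩
      rw [length_seg] at hi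
      rw [List.getD, getElem?_seg hi]
      exact (lt_or_ge i.unpair.1 k).symm.imp id (hg i)
  have hA : ¬ ∀ x, W x ↔ ∃ f, ¬ (U f () ∨ ∃ g, AgreeBelow k f g ∧ V g x) := fun H =>
    hW ⟨_, (hU.substParam (Computable.const ())).or hV', H⟩
  push Not at hA
  obtain ⟨x, ⟨hx, hA⟩ | ⟨hx, f, hfC, hf⟩⟩ := hA
  · obtain ⟨f, hf⟩ := hC.nonempty
    obtain ⟨g, hfg, hg⟩ := (hA f).resolve_left ((hUC f).1 hf)
    obtain ⟨Q, hQ, hm, h⟩ := hV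
    obtain ⟨n, hn⟩ := (h _ _).1 hg
    refine ⟨_, Set.inter_subset_left, hC.inter_seg (hk f g hfg hf) n, x, fun g' hg' => ?_⟩
    have : V g' x := (h _ _).2 ⟨n, by rwa [hg'.2]⟩
    tauto
  · refine ⟨_, Set.inter_subset_left, hC.inter (V := fun f (_ : Unit) => ∃ g, AgreeBelow k f g ∧ V g x)
      (k := k) (hV'.substParam (Computable.const x)) ⟨f, (hUC f).2 hfC, ?_⟩ ?_, x, ?_⟩
    · rintro ⟨g, h1, h2⟩
      exact hf g h1 h2
    · rintro f g hfg hf ⟨h, h1, h2⟩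
      exact hf ⟨h, fun i hi => (hfg i hi).trans (h1 i hi), h2⟩
    · rintro f ⟨-, hf⟩
      have : ¬ V f x := fun hV => hf ⟨f, fun _ _ => rfl, hV⟩
      tauto

theorem exists_condition_isPath {T : Set (List ℕ)} (hT : ComputableTree T) (hne : IllFounded T)
    {C : Set (ℕ → ℕ)} (hC : IsCondition C) :
    ∃ C' ⊆ C, IsCondition C' ∧ ∃ k, ∀ f ∈ C', IsPath T (f ∘ Nat.pair k) := by
  obtain ⟨hpre, χ, hχ, hTχ⟩ := hT
  obtain ⟨h, hh⟩ := hne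
  obtain ⟨k, hk⟩ := hC.bounded
  have hopen : EffOpen fun f (_ : Unit) => ∃ n, seg f n ∉ T := by
    refine ⟨fun _ l => l ∉ T, ?_, fun _ l l' hl hn hl' => hn (hpre _ hl' _ hl), by simp⟩
    have : ComputablePred fun l => χ l = true := by
      refine Computable.computablePred ?_
      simpa using hχ
    exact (this.not.to_re.comp Computable.snd).of_eq fun x => not_congr (hTχ x.2).symm
  obtain ⟨f, hf⟩ := hC.nonempty
  refine ⟨_, Set.inter_subset_left, hC.inter (V := fun f _ => ∃ n, seg (f ∘ Nat.pair k) n ∉ T)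
    (k := k + 1) (hopen.reindex (Primrec₂.natPair.comp (Primrec.const k) Primrec.id).to_comp)
    ⟨fun i => if i.unpair.1 = k then h i.unpair.2 else f i, ?_, ?_⟩ ?_, k, ?_⟩
  · refine hk f _ (fun i hi => ?_) hf
    simp [hi.ne]
  · rintro ⟨n, hn⟩
    refine hn ?_
    rw [seg_congr (g := h) (by simp)]
    exact hh n
  · rintro f g hfg hf ⟨n, hn⟩
    refine hf ⟨n, ?_⟩
    rwa [seg_congr (f := f ∘ Nat.pair k) (g := g ∘ Nat.pair k) fun i _ => hfg _ (by simp)]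
  · rintro f ⟨-, hf⟩ n
    by_contra hn
    exact hf ⟨n, hn⟩

theorem countable_computableTree : {T | ComputableTree T}.Countable := by
  refine (Set.countable_range fun (c : Code) => {l : List ℕ | (c.eval (encode l)).Dom}).mono ?_
  rintro T ⟨-, χ, hχ, h⟩
  have : ComputablePred fun l => χ l = true := by
    refine Computable.computablePred ?_
    simpa using hχ
  obtain ⟨c, hc⟩ := this.to_re.exists_code
  refine ⟨c, ?_⟩
  ext l
  rw [h, hc]
  exact Iff.rfl

/-- If `W` is not `Σ¹₁` then some `F` has a path through every ill-founded computable tree among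
its columns, while `W` is not `Π⁰₁` in `F`. -/
theorem exists_paths_not_effClosed {α : Type} [Primcodable α] {W : α → Prop}
    (hW : ¬ IsSigma11 W) :
    ∃ F : ℕ → ℕ, (∀ T, ComputableTree T → IllFounded T → ∃ k, IsPath T (F ∘ Nat.pair k)) ∧
      ∀ V : (ℕ → ℕ) → α → Prop, EffOpen V → ¬ ∀ x, W x ↔ ¬ V F x := by
  have : Countable {T | ComputableTree T} := countable_computableTree.to_subtype
  have : Countable {V : (ℕ → ℕ) → α → Prop | EffOpen V} := EffOpen.countable.to_subtype
  let D : {T | ComputableTree T} ⊕ {V : (ℕ → ℕ) → α → Prop | EffOpen V} → Set (Set (ℕ → ℕ)) :=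
    Sum.elim (fun T => {C | IllFounded T.1 → ∃ k, ∀ f ∈ C, IsPath T.1 (f ∘ Nat.pair k)})
      fun V => {C | ∃ x, ∀ f ∈ C, ¬ (W x ↔ ¬ V.1 f x)}
  have hD : ∀ i C, IsCondition C → ∃ C' ⊆ C, IsCondition C' ∧ C' ∈ D i := by
    rintro (⟨T, hT⟩ | ⟨V, hV⟩) C hC
    · by_cases hne : IllFounded T
      · obtain ⟨C', h1, h2, h3⟩ := exists_condition_isPath hT hne hC
        exact ⟨C', h1, h2, fun _ => h3⟩
      · exact ⟨C, subset_rfl, hC, fun h => absurd h hne⟩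
    · exact exists_condition_ne hW hV hC
  obtain ⟨F, hF⟩ := exists_generic D hD
  refine ⟨F, fun T hT hne => ?_, fun V hV H => ?_⟩
  · obtain ⟨C, hC, hFC⟩ := hF (.inl ⟨T, hT⟩)
    obtain ⟨k, hk⟩ := hC hne
    exact ⟨k, hk F hFC⟩
  · obtain ⟨C, ⟨x, hx⟩, hFC⟩ := hF (.inr ⟨V, hV⟩)
    exact hx F hFC (H x)

end Forcing

section Trees

/-- A step-by-step construction of a path all of whose initial segments satisfy `P`. -/
theorem exists_seg_of_step {P : List ℕ → Prop} (h0 : P [])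
    (hs : ∀ l, P l → ∃ n, P (l ++ [n])) : ∃ f : ℕ → ℕ, ∀ k, P (seg f k) := by
  choose! n hn using hs
  let l : ℕ → List ℕ := fun k => Nat.rec [] (fun _ l => l ++ [n l]) k
  have hl : ∀ k, seg (fun k => n (l k)) k = l k := fun k => by
    induction k with
    | zero => rfl
    | succ k ih => rw [seg_succ, ih]
  refine ⟨fun k => n (l k), fun k => ?_⟩
  rw [hl]
  induction k with
  | zero => exact h0
  | succ k ih => exact hn _ ih

theorem evaln_eq_none {c : Code} {n j k : ℕ} (hjk : j ≤ k) (h : Code.evaln k c n = none) :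
    Code.evaln j c n = none := by
  refine Option.eq_none_iff_forall_not_mem.2 fun y hy => ?_
  have := Code.evaln_mono hjk hy
  simp [h] at this

/-- A uniformly computable family of trees such that every `Σ¹₁` property of a number is
equivalent to the ill-foundedness of the corresponding tree, at some number. -/
theorem exists_universal_tree : ∃ T : ℕ × List ℕ → Prop, ComputablePred T ∧ (∀ a, T (a, [])) ∧
    (∀ a l l', l <+: l' → T (a, l') → T (a, l)) ∧
    ∀ U : (ℕ → ℕ) → ℕ → Prop, EffOpen U →
      ∃ a, (∃ f, ∀ k, T (a, seg f k)) ↔ ∃ f, ¬ U f a := by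
  refine ⟨fun x => ∀ k < x.2.length + 1, Code.evaln x.2.length (Denumerable.ofNat Code x.1)
    (encode (x.1, x.2.take k)) = none, ?_, ?_, ?_, ?_⟩
  · have : PrimrecRel fun (k : ℕ) (x : ℕ × List ℕ) => Code.evaln x.2.length
        (Denumerable.ofNat Code x.1) (encode (x.1, x.2.take k)) = none := by
      refine Primrec.eq.comp (Code.primrec_evaln.comp (((Primrec.list_length.comp
        (Primrec.snd.comp Primrec.snd)).pair ((Primrec.ofNat Code).comp
        (Primrec.fst.comp Primrec.snd))).pair (Primrec.encode.comp
        ((Primrec.fst.comp Primrec.snd).pair (Primrec.list_take.comp Primrec.fst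
          (Primrec.snd.comp Primrec.snd)))))) (Primrec.const none)
    refine PrimrecPred.computablePred ((this.forall_mem_list.comp (Primrec.list_range.comp
      (Primrec.succ.comp (Primrec.list_length.comp Primrec.snd))) Primrec.id).of_eq fun x => ?_)
    simp
  · intro a k _
    simp [Code.evaln]
  · rintro a l _ ⟨m, rfl⟩ h k hk
    have := h k (by simp at hk ⊢; omega)
    rw [List.take_append_of_le_length (Nat.lt_succ_iff.1 hk)] at this
    exact evaln_eq_none (by simp) this
  · rintro U ⟨Q, hQ, hm, hU⟩
    obtain ⟨c, hc⟩ := hQ.exists_code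
    refine ⟨encode c, exists_congr fun f => ?_⟩
    simp only [hU, Denumerable.ofNat_encode, length_seg]
    constructor
    · rintro h ⟨k, hk⟩
      obtain ⟨y, hy⟩ := Part.dom_iff_mem.1 ((hc (encode c, seg f k)).1 hk)
      obtain ⟨s, hs⟩ := Code.evaln_complete.1 hy
      have := h (max s k) k (by omega)
      rw [take_seg (le_max_right _ _)] at this
      have := evaln_eq_none (le_max_left _ _) this
      rw [this] at hs
      exact Option.not_mem_none _ hs
    · intro h j k hk
      refine Option.eq_none_iff_forall_not_mem.2 fun y hy => h ⟨k, (hc (encode c, seg f k)).2 ?_⟩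
      rw [take_seg (Nat.lt_succ_iff.1 hk)] at hy
      exact Part.dom_iff_mem.2 ⟨y, Code.evaln_sound hy⟩

end Trees

section KleeneBrouwer

/-- The strict Kleene–Brouwer order on finite sequences. -/
def KB : List ℕ → List ℕ → Prop
  | [], _ => False
  | _ :: _, [] => True
  | x :: l, y :: m => x < y ∨ x = y ∧ KB l m

@[simp] theorem not_KB_nil (l : List ℕ) : ¬ KB [] l := id

@[simp] theorem KB_cons_nil (x : ℕ) (l : List ℕ) : KB (x :: l) [] := trivial

@[simp] theorem KB_cons_cons {x y : ℕ} {l m : List ℕ} :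
    KB (x :: l) (y :: m) ↔ x < y ∨ x = y ∧ KB l m := Iff.rfl

theorem KB_irrefl (l : List ℕ) : ¬ KB l l := by
  induction l <;> simp [*]

theorem KB.trans {l m n : List ℕ} (h1 : KB l m) (h2 : KB m n) : KB l n := by
  induction l generalizing m n with
  | nil => exact h1
  | cons x l ih =>
    rcases m with _ | ⟨y, m⟩
    · exact h2.elim
    rcases n with _ | ⟨z, n⟩
    · trivial
    rcases h1 with h1 | ⟨rfl, h1⟩ <;> rcases h2 with h2 | ⟨rfl, h2⟩
    · exact .inl (h1.trans h2)
    · exact .inl h1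
    · exact .inl h2
    · exact .inr ⟨rfl, ih h1 h2⟩

theorem KB_trichotomy (l m : List ℕ) : l = m ∨ KB l m ∨ KB m l := by
  induction l generalizing m with
  | nil => cases m <;> simp
  | cons x l ih =>
    rcases m with _ | ⟨y, m⟩
    · simp
    · rcases lt_trichotomy x y with h | rfl | h
      · simp [h]
      · simpa using ih m
      · simp [h]

theorem not_KB_iff {l m : List ℕ} : ¬ KB l m ↔ l = m ∨ KB m l := by
  constructor
  · have := KB_trichotomy l m
    tauto
  · rintro (rfl | h) h'
    · exact KB_irrefl _ h'
    · exact KB_irrefl _ (h.trans h')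

theorem KB_append_singleton (l : List ℕ) (n : ℕ) : KB (l ++ [n]) l := by
  induction l <;> simp [*]

theorem KB_iff_exists {l m : List ℕ} : KB l m ↔ ∃ x : (List ℕ × List ℕ × List ℕ) × ℕ × ℕ,
    l = x.1.1 ++ x.2.1 :: x.1.2.1 ∧
      (m = x.1.1 ∨ m = x.1.1 ++ x.2.2 :: x.1.2.2 ∧ x.2.1 < x.2.2) := by
  constructor
  · intro h
    induction l generalizing m with
    | nil => exact h.elim
    | cons x l ih =>
      rcases m with _ | ⟨y, m⟩
      · exact ⟨(([], l, []), x, 0), by simp⟩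
      · rcases h with h | ⟨rfl, h⟩
        · exact ⟨(([], l, m), x, y), by simp [h]⟩
        · obtain ⟨⟨⟨p, s, t⟩, a, b⟩, h⟩ := ih h
          refine ⟨((x :: p, s, t), a, b), ?_⟩
          simpa using h
  · rintro ⟨⟨⟨p, s, t⟩, a, b⟩, rfl, rfl | ⟨rfl, h⟩⟩ <;> dsimp only at *
    · induction m <;> simp [*]
    · induction p <;> simp [*]

theorem computablePred_KB : ComputablePred fun x : List ℕ × List ℕ => KB x.1 x.2 := by
  have re : REPred fun x : List ℕ × List ℕ => KB x.1 x.2 := by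
    simp only [KB_iff_exists]
    refine REPred.exists (p := fun (y : List ℕ × List ℕ)
      (x : (List ℕ × List ℕ × List ℕ) × ℕ × ℕ) => y.1 = x.1.1 ++ x.2.1 :: x.1.2.1 ∧
        (y.2 = x.1.1 ∨ y.2 = x.1.1 ++ x.2.2 :: x.1.2.2 ∧ x.2.1 < x.2.2)) ?_
    have p : Primrec fun x : (List ℕ × List ℕ) × (List ℕ × List ℕ × List ℕ) × ℕ × ℕ => x.2.1.1 :=
      Primrec.fst.comp (Primrec.fst.comp Primrec.snd)
    have s : Primrec fun x : (List ℕ × List ℕ) × (List ℕ × List ℕ × List ℕ) × ℕ × ℕ =>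
        x.2.1.2 := Primrec.snd.comp (Primrec.fst.comp Primrec.snd)
    have a : Primrec fun x : (List ℕ × List ℕ) × (List ℕ × List ℕ × List ℕ) × ℕ × ℕ => x.2.2.1 :=
      Primrec.fst.comp (Primrec.snd.comp Primrec.snd)
    have b : Primrec fun x : (List ℕ × List ℕ) × (List ℕ × List ℕ × List ℕ) × ℕ × ℕ => x.2.2.2 :=
      Primrec.snd.comp (Primrec.snd.comp Primrec.snd)
    have l := Primrec.fst.comp (Primrec.fst (α := List ℕ × List ℕ)
      (β := (List ℕ × List ℕ × List ℕ) × ℕ × ℕ))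
    have m := Primrec.snd.comp (Primrec.fst (α := List ℕ × List ℕ)
      (β := (List ℕ × List ℕ × List ℕ) × ℕ × ℕ))
    refine PrimrecPred.computablePred (PrimrecPred.and ?_ (PrimrecPred.or ?_
      (PrimrecPred.and ?_ ?_))) |>.to_re
    · exact Primrec.eq.comp l
        (Primrec.list_append.comp p (Primrec.list_cons.comp a (Primrec.fst.comp s)))
    · exact Primrec.eq.comp m p
    · exact Primrec.eq.comp m
        (Primrec.list_append.comp p (Primrec.list_cons.comp b (Primrec.snd.comp s)))
    · exact Primrec.nat_lt.comp a b
  refine ComputablePred.computable_iff_re_compl_re'.2 ⟨re, ?_⟩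
  simp only [not_KB_iff]
  exact REPred.or Primrec.eq.computablePred.to_re
    (re.comp (f := fun x : List ℕ × List ℕ => (x.2, x.1)) (Computable.snd.pair Computable.fst))

/-- The Kleene–Brouwer order restricted to `S`. -/
def KBOn (S : List ℕ → Prop) (l m : List ℕ) : Prop := S l ∧ S m ∧ KB l m

/-- A Kleene–Brouwer descending sequence in a tree yields a path. -/
theorem exists_path_of_KB_desc {S : List ℕ → Prop} (hS : ∀ l l', l <+: l' → S l' → S l)
    {g : ℕ → List ℕ} (hg : ∀ i, S (g i) ∧ KB (g (i + 1)) (g i)) : ∃ f, ∀ k, S (seg f k) := by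
  have := exists_seg_of_step
    (P := fun l => ∃ g : ℕ → List ℕ, ∀ i, S (l ++ g i) ∧ KB (g (i + 1)) (g i)) ⟨g, hg⟩ ?_
  · obtain ⟨f, hf⟩ := this
    refine ⟨f, fun k => ?_⟩
    obtain ⟨g, hg⟩ := hf k
    exact hS _ _ (List.prefix_append _ _) (hg 0).1
  · rintro l ⟨g, hg⟩
    have : ∀ i, ∃ x t, g (i + 1) = x :: t := fun i =>
      List.exists_cons_of_ne_nil fun h => by simpa [h] using (hg i).2
    choose h t ht using this
    have hlt : ∀ i, h (i + 1) < h i ∨ h (i + 1) = h i ∧ KB (t (i + 1)) (t i) := fun i => by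
      simpa [ht] using (hg (i + 1)).2
    have anti : Antitone h := antitone_nat_of_succ_le fun i => by
      rcases hlt i with h | h
      exacts [h.le, h.1.le]
    obtain ⟨i, hi⟩ : ∃ i, ∀ j, h i ≤ h j := ⟨_, fun j => Function.argmin_le h j⟩
    have heq : ∀ j, h (i + j) = h i := fun j => (anti (Nat.le_add_right i j)).antisymm (hi _)
    refine ⟨h i, fun j => t (i + j), fun j => ⟨?_, ?_⟩⟩
    · have := (hg (i + j + 1)).1
      rw [ht, heq] at this
      simpa using this
    · have := hlt (i + j)
      rw [add_assoc, heq, heq] at this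
      simpa using this

end KleeneBrouwer

section Ranking

/-- The `n`-th immediate successor of a node. -/
def child (s : ℕ × List ℕ) (n : ℕ) : ℕ × List ℕ := (s.1, s.2 ++ [n])

theorem child_seg (a : ℕ) (f : ℕ → ℕ) (k : ℕ) : child (a, seg f k) (f k) = (a, seg f (k + 1)) := by
  rw [child, seg_succ]

theorem computable_child {α : Type} [Primcodable α] {s : α → ℕ × List ℕ} {n : α → ℕ}
    (hs : Computable s) (hn : Computable n) : Computable fun a => child (s a) (n a) :=
  (Primrec.pair (Primrec.fst.comp Primrec.fst) (Primrec.list_append.comp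
    (Primrec.snd.comp Primrec.fst) (Primrec.list_cons.comp Primrec.snd
      (Primrec.const [])))).to_comp.comp (f := fun x : (ℕ × List ℕ) × ℕ => child x.1 x.2)
    (hs.pair hn)

/-- `h` attempts to rank the nodes of all trees `T (i, ·)` in the Kleene–Brouwer order of the tree
`T (e, ·)`, with the top element `[]` standing for failure. -/
structure IsRanking (T : ℕ × List ℕ → Prop) (e : ℕ) (h : ℕ × List ℕ → List ℕ) : Prop where
  mem : ∀ s, T (e, h s)
  lt : ∀ s n, T (child s n) → h s ≠ [] → KB (h (child s n)) (h s)
  exists_child : ∀ s y, T (e, y) → KB y (h s) →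
    ∃ n, T (child s n) ∧ ¬ KB (h (child s n)) y

/-- The relation that the tree above a node can be ranked below an element of `r`. -/
inductive HasRank (T : ℕ × List ℕ → Prop) (r : List ℕ → List ℕ → Prop) :
    List ℕ → ℕ × List ℕ → Prop
  | intro (x : List ℕ) (s : ℕ × List ℕ) (y : ℕ → List ℕ) :
      (∀ n, T (child s n) → r (y n) x) →
      (∀ n, T (child s n) → HasRank T r (y n) (child s n)) → HasRank T r x s

theorem exists_isRanking {T : ℕ × List ℕ → Prop} (hnil : ∀ a, T (a, []))
    (hpre : ∀ a l l', l <+: l' → T (a, l') → T (a, l)) {e : ℕ}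
    (he : ¬ ∃ f, ∀ k, T (e, seg f k)) : ∃ h, IsRanking T e h := by
  have wf : WellFounded (KBOn fun l => T (e, l)) := by
    rw [wellFounded_iff_isEmpty_descending_chain]
    exact ⟨fun ⟨g, hg⟩ => he (exists_path_of_KB_desc (hpre e)
      fun i => ⟨(hg i).2.1, (hg i).2.2⟩)⟩
  have key : ∀ s, ∃ x, T (e, x) ∧ (x ≠ [] → HasRank T (KBOn fun l => T (e, l)) x s) ∧
      ∀ z, T (e, z) → HasRank T (KBOn fun l => T (e, l)) z s → ¬ KB z x := by
    intro s
    by_cases hs : ∃ x, T (e, x) ∧ HasRank T (KBOn fun l => T (e, l)) x s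
    · obtain ⟨x, ⟨hx, hxs⟩, hmin⟩ := wf.has_min {x | T (e, x) ∧ HasRank T _ x s} hs
      exact ⟨x, hx, fun _ => hxs, fun z hz hzs hlt => hmin z ⟨hz, hzs⟩ ⟨hz, hx, hlt⟩⟩
    · exact ⟨[], hnil e, fun h => absurd rfl h, fun z hz hzs => absurd ⟨z, hz, hzs⟩ hs⟩
  choose h hmem hrank hmin using key
  refine ⟨h, hmem, fun s n hn hs => ?_, fun s y hy hlt => ?_⟩
  · obtain ⟨_, _, y, hy, hys⟩ := hrank s hs
    rcases not_KB_iff.1 (hmin _ _ (hy n hn).1 (hys n hn)) with h | h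
    · exact h ▸ (hy n hn).2.2
    · exact h.trans (hy n hn).2.2
  · by_contra! H
    refine hmin s y hy (.intro y s (fun n => h (child s n))
      (fun n hn => ⟨hmem _, hy, H n hn⟩) fun n hn => hrank _ fun h0 => ?_) hlt
    have := H n hn
    rw [h0] at this
    exact this

/-- In an ill-founded Kleene–Brouwer order, a ranking sends exactly the well-founded trees into
the well-founded part. -/
theorem IsRanking.acc_iff {T : ℕ × List ℕ → Prop} {e : ℕ} {h : ℕ × List ℕ → List ℕ}
    (hr : IsRanking T e h) (hnil : ∀ a, T (a, [])) {p : ℕ → ℕ} (hp : ∀ k, T (e, seg p k)) (a : ℕ) :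
    Acc (KBOn fun l => T (e, l)) (h (a, [])) ↔ ¬ ∃ f, ∀ k, T (a, seg f k) := by
  have top : ¬ Acc (KBOn fun l => T (e, l)) [] :=
    not_acc_iff_exists_descending_chain.2 ⟨fun n => seg p n, rfl, fun n =>
      ⟨hp _, hp _, by simpa only [seg_succ] using KB_append_singleton _ _⟩⟩
  constructor
  · rintro ha ⟨f, hf⟩
    have step : ∀ k, Acc (KBOn fun l => T (e, l)) (h (a, seg f k)) →
        KBOn (fun l => T (e, l)) (h (a, seg f (k + 1))) (h (a, seg f k)) := fun k hk => by
      have := hr.lt (a, seg f k) (f k) (by rw [child_seg]; exact hf (k + 1))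
        fun h0 => top (h0 ▸ hk)
      rw [child_seg] at this
      exact ⟨hr.mem _, hr.mem _, this⟩
    have acc : ∀ k, Acc (KBOn fun l => T (e, l)) (h (a, seg f k)) := fun k => by
      induction k with
      | zero => exact ha
      | succ k ih => exact ih.inv (step k ih)
    exact not_acc_iff_exists_descending_chain.2
      ⟨fun k => h (a, seg f k), rfl, fun k => step k (acc k)⟩ ha
  · intro hwf
    by_contra ha
    obtain ⟨f, hf⟩ := exists_seg_of_step
      (P := fun l => T (a, l) ∧ ¬ Acc (KBOn fun l => T (e, l)) (h (a, l))) ⟨hnil a, ha⟩ (by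
        rintro l ⟨-, hl⟩
        obtain ⟨y, hy, hlt⟩ := exists_not_acc_lt_of_not_acc hl
        obtain ⟨n, hn, hny⟩ := hr.exists_child (a, l) y hlt.1 hlt.2.2
        refine ⟨n, hn, fun hacc => hy ?_⟩
        rcases not_KB_iff.1 hny with h | h
        · exact h ▸ hacc
        · exact hacc.inv ⟨hlt.1, hr.mem _, h⟩)
    exact hwf ⟨f, fun k => (hf k).1⟩

theorem EffOpen.subst {α : Type} [Primcodable α] {U : (ℕ → ℕ) → α → ℕ → Prop}
    (hU : EffOpen fun f (x : α × ℕ) => U f x.1 x.2) {t : α → ℕ} (ht : Computable t) :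
    EffOpen fun f a => U f a (f (t a)) := by
  refine (EffOpen.ex (U := fun f a v => f (t a) = v ∧ U f a v)
    ((EffOpen.apply (ht.comp Computable.fst) Computable.snd).and hU)).of_iff fun f a => ?_
  simp

/-- The function between codable types coded by an element of Baire space. -/
def decodeFn (f : ℕ → ℕ) (s : ℕ × List ℕ) : List ℕ := Denumerable.ofNat (List ℕ) (f (encode s))

theorem exists_decodeFn_eq (h : ℕ × List ℕ → List ℕ) : ∃ f, decodeFn f = h :=
  ⟨fun n => encode (h (Denumerable.ofNat _ n)), funext fun s => by
    rw [decodeFn, Denumerable.ofNat_encode, Denumerable.ofNat_encode]⟩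

theorem EffOpen.subst_decodeFn {α : Type} [Primcodable α] {U : (ℕ → ℕ) → α → List ℕ → Prop}
    (hU : EffOpen fun f (x : α × List ℕ) => U f x.1 x.2) {t : α → ℕ × List ℕ}
    (ht : Computable t) {g : ℕ → ℕ} (hg : Computable g) :
    EffOpen fun f a => U f a (decodeFn (f ∘ g) (t a)) := by
  refine EffOpen.subst (U := fun f a v => U f a (Denumerable.ofNat (List ℕ) v))
    (hU.substParam (g := fun x : α × ℕ => (x.1, Denumerable.ofNat (List ℕ) x.2)) ?_)
    (t := fun a => g (encode (t a))) ?_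
  · exact Computable.fst.pair ((Computable.ofNat _).comp Computable.snd)
  · exact hg.comp (Computable.encode.comp ht)

theorem computable_natPair (c : ℕ) : Computable (Nat.pair c) :=
  (Primrec₂.natPair.comp (Primrec.const c) Primrec.id).to_comp

theorem exists_columns (f g : ℕ → ℕ) : ∃ h : ℕ → ℕ, h ∘ Nat.pair 0 = f ∧ h ∘ Nat.pair 1 = g :=
  ⟨fun n => if n.unpair.1 = 0 then f n.unpair.2 else g n.unpair.2, by ext; simp, by ext; simp⟩

theorem rePred_KB {α : Type} [Primcodable α] {l m : α → List ℕ} (hl : Computable l)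
    (hm : Computable m) : REPred fun a => KB (l a) (m a) :=
  REPred.comp (f := fun a => (l a, m a)) computablePred_KB.to_re (hl.pair hm)

theorem rePred_not_KB {α : Type} [Primcodable α] {l m : α → List ℕ} (hl : Computable l)
    (hm : Computable m) : REPred fun a => ¬ KB (l a) (m a) :=
  REPred.comp (f := fun a => (l a, m a)) computablePred_KB.not.to_re (hl.pair hm)

theorem effOpen_decodeFn_mem {T : ℕ × List ℕ → Prop} (hT : ComputablePred T) :
    EffOpen fun f (e : ℕ) => ∃ s : ℕ × List ℕ, ¬ T (e, decodeFn (f ∘ Nat.pair 0) s) := by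
  refine EffOpen.ex (U := fun f e s => ¬ T (e, decodeFn (f ∘ Nat.pair 0) s)) ?_
  refine EffOpen.subst_decodeFn (U := fun f (x : ℕ × (ℕ × List ℕ)) l => ¬ T (x.1, l))
    (.of_re ?_) Computable.snd (computable_natPair 0)
  exact hT.not.to_re.comp (f := fun x : (ℕ × (ℕ × List ℕ)) × List ℕ => (x.1.1, x.2))
    ((Computable.fst.comp Computable.fst).pair Computable.snd)

theorem effOpen_decodeFn_lt {T : ℕ × List ℕ → Prop} (hT : ComputablePred T) :
    EffOpen fun f (_ : ℕ) => ∃ s : (ℕ × List ℕ) × ℕ, T (child s.1 s.2) ∧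
      decodeFn (f ∘ Nat.pair 0) s.1 ≠ [] ∧ ¬ KB (decodeFn (f ∘ Nat.pair 0) (child s.1 s.2))
        (decodeFn (f ∘ Nat.pair 0) s.1) := by
  refine EffOpen.ex (U := fun f (_ : ℕ) (s : (ℕ × List ℕ) × ℕ) => T (child s.1 s.2) ∧
    decodeFn (f ∘ Nat.pair 0) s.1 ≠ [] ∧ ¬ KB (decodeFn (f ∘ Nat.pair 0) (child s.1 s.2))
      (decodeFn (f ∘ Nat.pair 0) s.1)) ?_
  have hchild : Computable fun x : (ℕ × (ℕ × List ℕ) × ℕ) × List ℕ => child x.1.2.1 x.1.2.2 :=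
    computable_child (Computable.fst.comp (Computable.snd.comp Computable.fst))
      (Computable.snd.comp (Computable.snd.comp Computable.fst))
  refine EffOpen.and (.of_re (hT.to_re.comp (computable_child
    (Computable.fst.comp Computable.snd) (Computable.snd.comp Computable.snd)))) ?_
  refine EffOpen.subst_decodeFn (U := fun f (x : ℕ × (ℕ × List ℕ) × ℕ) l => l ≠ [] ∧
    ¬ KB (decodeFn (f ∘ Nat.pair 0) (child x.2.1 x.2.2)) l) (EffOpen.and (.of_re ?_) ?_)
    (Computable.fst.comp Computable.snd) (computable_natPair 0)
  · exact ((Primrec.eq.comp Primrec.snd (Primrec.const [])).not).computablePred.to_re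
  · refine EffOpen.subst_decodeFn (U := fun f (x : (ℕ × (ℕ × List ℕ) × ℕ) × List ℕ) l =>
      ¬ KB l x.2) (.of_re ?_) hchild (computable_natPair 0)
    exact rePred_not_KB Computable.snd (Computable.snd.comp Computable.fst)

theorem effOpen_decodeFn_exists_child {T : ℕ × List ℕ → Prop} (hT : ComputablePred T) :
    EffOpen fun f (e : ℕ) => ∃ s : (ℕ × List ℕ) × List ℕ, T (e, s.2) ∧
      KB s.2 (decodeFn (f ∘ Nat.pair 0) s.1) ∧ (¬ T (child s.1 (f (Nat.pair 1 (encode s)))) ∨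
        KB (decodeFn (f ∘ Nat.pair 0) (child s.1 (f (Nat.pair 1 (encode s))))) s.2) := by
  refine EffOpen.ex (U := fun f (e : ℕ) (s : (ℕ × List ℕ) × List ℕ) => T (e, s.2) ∧
    KB s.2 (decodeFn (f ∘ Nat.pair 0) s.1) ∧ (¬ T (child s.1 (f (Nat.pair 1 (encode s)))) ∨
      KB (decodeFn (f ∘ Nat.pair 0) (child s.1 (f (Nat.pair 1 (encode s))))) s.2))
    (EffOpen.and (.of_re ?_) (EffOpen.and ?_ ?_))
  · exact hT.to_re.comp (Computable.fst.pair (Computable.snd.comp Computable.snd))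
  · refine EffOpen.subst_decodeFn (U := fun f (x : ℕ × (ℕ × List ℕ) × List ℕ) l => KB x.2.2 l)
      (.of_re ?_) (Computable.fst.comp Computable.snd) (computable_natPair 0)
    exact rePred_KB (Computable.snd.comp (Computable.snd.comp Computable.fst)) Computable.snd
  · refine EffOpen.subst (U := fun f (x : ℕ × (ℕ × List ℕ) × List ℕ) n =>
      ¬ T (child x.2.1 n) ∨ KB (decodeFn (f ∘ Nat.pair 0) (child x.2.1 n)) x.2.2) ?_
      (t := fun x => Nat.pair 1 (encode x.2))
      (Primrec₂.natPair.comp (Primrec.const 1) (Primrec.encode.comp Primrec.snd)).to_comp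
    have hchild : Computable fun x : (ℕ × (ℕ × List ℕ) × List ℕ) × ℕ => child x.1.2.1 x.2 :=
      computable_child (Computable.fst.comp (Computable.snd.comp Computable.fst)) Computable.snd
    refine EffOpen.or (.of_re (hT.not.to_re.comp hchild)) ?_
    refine EffOpen.subst_decodeFn
      (U := fun f (x : (ℕ × (ℕ × List ℕ) × List ℕ) × ℕ) l => KB l x.1.2.2) (.of_re ?_) hchild (computable_natPair 0)
    exact rePred_KB Computable.snd (Computable.snd.comp (Computable.snd.comp
      (Computable.fst.comp Computable.fst)))

/-- Being a ranking is `Π⁰₁` up to Skolemization. -/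
theorem exists_effOpen_isRanking {T : ℕ × List ℕ → Prop} (hT : ComputablePred T) :
    ∃ U : (ℕ → ℕ) → ℕ → Prop, EffOpen U ∧
      (∀ f e, ¬ U f e → IsRanking T e (decodeFn (f ∘ Nat.pair 0))) ∧
      ∀ e h, IsRanking T e h → ∃ f, ¬ U f e := by
  refine ⟨_, (effOpen_decodeFn_mem hT).or
    ((effOpen_decodeFn_lt hT).or (effOpen_decodeFn_exists_child hT)), fun f e hU => ?_, fun e h hr => ?_⟩
  · push Not at hU
    obtain ⟨hmem, hlt, hchild⟩ := hU
    exact ⟨hmem, fun s n => hlt (s, n), fun s y hy hys =>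
      ⟨_, hchild (s, y) hy hys⟩⟩
  · obtain ⟨f, rfl⟩ := exists_decodeFn_eq h
    have := fun s : (ℕ × List ℕ) × List ℕ => hr.exists_child s.1 s.2
    choose! w hw using this
    obtain ⟨g, g0, g1⟩ := exists_columns f fun n => w (Denumerable.ofNat _ n)
    replace g1 : ∀ s, g (Nat.pair 1 (encode s)) = w s := fun s => by
      rw [← Function.comp_apply (f := g), g1]
      exact congrArg w (Denumerable.ofNat_encode s)
    refine ⟨g, ?_⟩
    rw [g0]
    simp only [g1]
    push Not
    exact ⟨hr.mem, fun s => hr.lt s.1 s.2, hw⟩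

/-- There is a computable set `S` of finite sequences on which the Kleene–Brouwer order is
ill-founded with a well-founded part that is not `Σ¹₁`. -/
theorem exists_KBOn_not_isSigma11 : ∃ S : List ℕ → Prop, ComputablePred S ∧
    (∃ p, ∀ k, S (seg p k)) ∧ ¬ IsSigma11 fun x => S x ∧ Acc (KBOn S) x := by
  obtain ⟨T, hT, hnil, hpre, huniv⟩ := exists_universal_tree
  have hWF : ¬ IsSigma11 fun a => ¬ ∃ f, ∀ k, T (a, seg f k) := by
    rintro ⟨U, hU, h⟩
    obtain ⟨a, ha⟩ := huniv U hU
    rw [← h] at ha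
    tauto
  obtain ⟨R, hR, hrank, hexists⟩ := exists_effOpen_isRanking hT
  obtain ⟨e, ⟨f, hf⟩, p, hp⟩ : ∃ e, (∃ f, ¬ R f e) ∧ ∃ p, ∀ k, T (e, seg p k) := by
    by_contra H
    refine hWF ⟨R, hR, fun a => ⟨fun ha => ?_, fun hf hp => H ⟨a, hf, hp⟩⟩⟩
    obtain ⟨h, hh⟩ := exists_isRanking hnil hpre ha
    exact hexists a h hh
  refine ⟨fun l => T (e, l), ?_, ⟨p, hp⟩, ?_⟩
  · obtain ⟨hT₁, hT₂⟩ := ComputablePred.computable_iff_re_compl_re'.1 hT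
    have hpair : Computable fun l : List ℕ => (e, l) := (Computable.const e).pair Computable.id
    exact ComputablePred.computable_iff_re_compl_re'.2 ⟨hT₁.comp hpair, hT₂.comp hpair⟩
  rintro ⟨V, hV, hW⟩
  refine hWF ⟨fun f a => R (f ∘ Nat.pair 0) e ∨
    V (f ∘ Nat.pair 1) (decodeFn ((f ∘ Nat.pair 0) ∘ Nat.pair 0) (a, [])), ?_, fun a => ?_⟩
  · refine ((hR.substParam (Computable.const e)).reindex (computable_natPair 0)).or ?_
    refine EffOpen.subst_decodeFn (U := fun f (_ : ℕ) l => V (f ∘ Nat.pair 1) l)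
      ((hV.reindex (computable_natPair 1)).substParam Computable.snd)
      (t := fun a => (a, [])) (Computable.id.pair (Computable.const []))
      (g := Nat.pair 0 ∘ Nat.pair 0) ((computable_natPair 0).comp (computable_natPair 0))
  · constructor
    · intro ha
      obtain ⟨v, hv⟩ := (hW _).1 ⟨(hrank f e hf).mem _, ((hrank f e hf).acc_iff hnil hp a).2 ha⟩
      obtain ⟨g, g0, g1⟩ := exists_columns f v
      refine ⟨g, ?_⟩
      beta_reduce
      rw [g0, g1]
      exact not_or_intro hf hv
    · rintro ⟨g, hg⟩
      have hr := hrank _ _ (not_or.1 hg).1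
      exact (hr.acc_iff hnil hp a).1 ((hW _).2 ⟨_, (not_or.1 hg).2⟩).2

end Ranking

section Order

/-- The Kleene–Brouwer order on `S`, transferred to the natural numbers. -/
def kbOrd (S : List ℕ → Prop) : LinOrd where
  dom := {n | S (Denumerable.ofNat (List ℕ) n)}
  lt a b := KBOn S (Denumerable.ofNat (List ℕ) a) (Denumerable.ofNat (List ℕ) b)

theorem exists_computable_bool {α : Type} [Primcodable α] {p : α → Prop} (hp : ComputablePred p) :
    ∃ χ : α → Bool, Computable χ ∧ ∀ a, p a ↔ χ a = true := by
  classical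
  exact ⟨fun a => decide (p a), hp.decide, by simp⟩

theorem computableLinOrd_kbOrd {S : List ℕ → Prop} (hS : ComputablePred S) :
    ComputableLinOrd (kbOrd S) := by
  obtain ⟨s, hs, hSs⟩ := exists_computable_bool hS
  obtain ⟨k, hk, hKk⟩ := exists_computable_bool computablePred_KB
  have hnat : Computable (Denumerable.ofNat (List ℕ)) := Computable.ofNat _
  refine ⟨⟨fun a b h => ⟨h.1, h.2.1⟩, fun a h => KB_irrefl _ h.2.2, fun a b c h1 h2 =>
    ⟨h1.1, h2.2.1, h1.2.2.trans h2.2.2⟩, fun a ha b hb => ?_⟩, ⟨_, hs.comp hnat, fun a => hSs _⟩,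
    fun a b => s (Denumerable.ofNat (List ℕ) a) && (s (Denumerable.ofNat (List ℕ) b) &&
      k (Denumerable.ofNat (List ℕ) a, Denumerable.ofNat (List ℕ) b)), ?_, fun a b => ?_⟩
  · rcases KB_trichotomy (Denumerable.ofNat (List ℕ) a) (Denumerable.ofNat (List ℕ) b) with h | h | h
    · exact .inl ((Denumerable.eqv (List ℕ)).symm.injective h)
    · exact .inr (.inl ⟨ha, hb, h⟩)
    · exact .inr (.inr ⟨hb, ha, h⟩)
  · have ha : Computable fun x : ℕ × ℕ => Denumerable.ofNat (List ℕ) x.1 :=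
      hnat.comp Computable.fst
    have hb : Computable fun x : ℕ × ℕ => Denumerable.ofNat (List ℕ) x.2 :=
      hnat.comp Computable.snd
    exact Primrec.and.to_comp.comp (hs.comp ha)
      (Primrec.and.to_comp.comp (hs.comp hb) (hk.comp (ha.pair hb)))
  · simp only [kbOrd, KBOn, hSs, Bool.and_eq_true, ← hKk]

theorem isDescSeq_kbOrd {S : List ℕ → Prop} {f : ℕ → ℕ} :
    IsDescSeq (kbOrd S) f ↔ ∀ i, KBOn S (Denumerable.ofNat (List ℕ) (f (i + 1)))
      (Denumerable.ofNat (List ℕ) (f i)) :=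
  forall_congr' fun _ => and_iff_right_of_imp fun h => h.2.1

/-- A tight descending sequence defines the well-founded part. -/
theorem acc_iff_of_isTightDescSeq {S : List ℕ → Prop} {f : ℕ → ℕ}
    (hf : IsTightDescSeq (kbOrd S) f) (x : List ℕ) : S x ∧ Acc (KBOn S) x ↔
      ¬ (¬ S x ∨ ∃ m, ¬ KB x (Denumerable.ofNat (List ℕ) (f m))) := by
  have hdesc := isDescSeq_kbOrd.1 hf.1
  push Not
  refine and_congr_right fun hx => ⟨fun hacc m => ?_, fun H => ?_⟩
  · by_contra h
    have : Acc (KBOn S) (Denumerable.ofNat (List ℕ) (f m)) := by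
      rcases not_KB_iff.1 h with h | h
      · exact h ▸ hacc
      · exact hacc.inv ⟨(hdesc m).2.1, hx, h⟩
    exact not_acc_iff_exists_descending_chain.2
      ⟨fun i => Denumerable.ofNat (List ℕ) (f (m + i)), rfl, fun i => hdesc (m + i)⟩ this
  · by_contra hacc
    obtain ⟨g, rfl, hg⟩ := not_acc_iff_exists_descending_chain.1 hacc
    obtain ⟨m, hm⟩ := hf.2 (fun i => encode (g i))
      (isDescSeq_kbOrd.2 fun i => by simpa only [Denumerable.ofNat_encode] using hg i) 0
    refine KB_irrefl _ ((H m).trans ?_)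
    simpa only [Denumerable.ofNat_encode] using hm.2.2

end Order

/-- There is a set that is high for paths but not high for tight
descending sequences. -/
theorem exists_highForPaths_not_highForTightDS :
    ∃ X : Set ℕ, HighForPaths X ∧
      ∃ L : LinOrd, ComputableLinOrd L ∧ L.IllFounded ∧
        ¬ ∃ f : ℕ → ℕ, ComputableIn (chi X) f ∧ IsTightDescSeq L f := by
  obtain ⟨S, hS, ⟨p, hp⟩, hW⟩ := exists_KBOn_not_isSigma11
  obtain ⟨F, hpaths, hF⟩ := exists_paths_not_effClosed hW
  refine ⟨coGraph F, fun T hT hne => ?_, kbOrd S, computableLinOrd_kbOrd hS,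
    ⟨fun n => encode (seg p n), isDescSeq_kbOrd.2 fun n => ?_⟩, ?_⟩
  · obtain ⟨k, hk⟩ := hpaths T hT hne
    exact ⟨_, computableIn_coGraph_comp F (computable_natPair k), hk⟩
  · simp only [Denumerable.ofNat_encode]
    exact ⟨hp _, hp _, by simpa only [seg_succ] using KB_append_singleton _ _⟩
  · rintro ⟨f, hf, htight⟩
    obtain ⟨G, hG, hGf⟩ := RecursiveIn.exists_effOpen (computableIn_nat.1 hf)
    refine hF (fun h x => ¬ S x ∨ ∃ y : ℕ × ℕ, G h y ∧ ¬ KB x (Denumerable.ofNat (List ℕ) y.2))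
      (EffOpen.or (.of_re hS.not.to_re) (EffOpen.ex (U := fun h x (y : ℕ × ℕ) =>
        G h y ∧ ¬ KB x (Denumerable.ofNat (List ℕ) y.2)) ((hG.substParam Computable.snd).and
          (.of_re (rePred_not_KB Computable.fst ((Computable.ofNat _).comp
            (Computable.snd.comp Computable.snd))))))) fun x => ?_
    rw [acc_iff_of_isTightDescSeq htight]
    simp [← hGf]

end CFT
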